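/- Let n ≥ 2, p ∈ {1,…,n−1} with gcd(n,p) = 1, q ∈ {1,…,n−1} with pq ≡ 1 (mod n), and let y be a type (i) coupling. Then for every ξ ∈ A_y^+ and every j ∈ {1,…,n}: z_j(ξ,y)·z_j(ξ,−y) = ∏_{m=j+1}^{j+n−1} [ 1 − sin²(y)/sin²(Σ_{k=j}^{m−1} ξ_k) ] > 0, and for every θ ∈ ℝ^{n−1} (with θ_0 = θ_n = 0) the real part of the trace of the local Lax matrix equals the III_b Hamiltonian: Re(tr L(ξ,θ)) = Σ_{j=1}^n cos(θ_j − θ_{j−1}) · √( ∏_{m=j+1}^{j+n−1} [ 1 − sin²(y)/sin²(Σ_{k=j}^{m−1} ξ_k) ] ). -/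

import Mathlib

open Finset Matrix
open scoped BigOperators Real

noncomputable section

/-- Entries of the `(n-1) × (n-1)` integer matrix `A` (1-based indices):
`A_{j,k} = 1` if `1 ≤ j ≤ n-p` and `j ≤ k < j+p`, `A_{j,k} = -1` if
`n-p < j ≤ n-1` and `j+p-n ≤ k < j`, and `0` otherwise. -/
def Aent (n p : ℕ) (j k : ℕ) : ℤ :=
  if j ≤ n - p ∧ j ≤ k ∧ k < j + p then 1
  else if n - p < j ∧ j + p ≤ k + n ∧ k < j then -1
  else 0

open Classical in
/-- Entries of the binary matrix `B`: `B_{m,k} = 0` iff `k - m ≡ ℓ p (mod n)`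
for some `ℓ ∈ {1, …, n-q}`, else `1`. -/
def Bent (n p q : ℕ) (m k : ℕ) : ℤ :=
  if ∃ ℓ ∈ Finset.Icc 1 (n - q), ((k : ℤ) - (m : ℤ)) ≡ ((ℓ * p : ℕ) : ℤ) [ZMOD (n : ℤ)]
  then 0 else 1

open Classical in
/-- Entries of the binary matrix `C`: `C_{m,k} = 0` iff `k ≡ ℓ p (mod n)`
for some `ℓ ∈ {1, …, n-q}`, else `1`. -/
def Cent (n p q : ℕ) (m k : ℕ) : ℤ :=
  if ∃ ℓ ∈ Finset.Icc 1 (n - q), ((k : ℤ)) ≡ ((ℓ * p : ℕ) : ℤ) [ZMOD (n : ℤ)]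
  then 0 else 1

/-- Entries of `Ω = B - C`. -/
def Ωent (n p q : ℕ) (m k : ℕ) : ℤ := Bent n p q m k - Cent n p q m k

/-- The matrix `A` as an `(n-1) × (n-1)` integer matrix. -/
def Amat (n p : ℕ) : Matrix (Fin (n - 1)) (Fin (n - 1)) ℤ :=
  fun j k => Aent n p (j.1 + 1) (k.1 + 1)

/-- The matrix `Ω = B - C` as an `(n-1) × (n-1)` integer matrix. -/
def Ωmat (n p q : ℕ) : Matrix (Fin (n - 1)) (Fin (n - 1)) ℤ :=
  fun j k => Ωent n p q (j.1 + 1) (k.1 + 1)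

/-- Cyclic window sum `ξ_ℓ + ξ_{ℓ+1} + ⋯ + ξ_{ℓ+d-1}`. -/
def wsum (ξ : ℕ → ℝ) (ℓ d : ℕ) : ℝ := ∑ m ∈ Finset.range d, ξ (ℓ + m)

/-- First type (i) interval: `(p/n - 1/(nq))π < y < pπ/n` (so `M = pπ - ny > 0`). -/
def typeI1 (n p q : ℕ) (y : ℝ) : Prop :=
  ((p : ℝ) / n - 1 / ((n : ℝ) * q)) * Real.pi < y ∧ y < (p : ℝ) * Real.pi / n

/-- Second type (i) interval: `pπ/n < y < (p/n + 1/(n(n-q)))π` (so `M = pπ - ny < 0`). -/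
def typeI2 (n p q : ℕ) (y : ℝ) : Prop :=
  (p : ℝ) * Real.pi / n < y ∧ y < ((p : ℝ) / n + 1 / ((n : ℝ) * ((n : ℝ) - q))) * Real.pi

/-- `M = pπ - ny`. -/
def Mval (n p : ℕ) (y : ℝ) : ℝ := (p : ℝ) * Real.pi - (n : ℝ) * y

/-- Membership of `ξ` (a cyclic sequence of reals, indices `1, …, n`) in the open
domain `A_y^+`: cyclic convention `ξ_{m+n} = ξ_m`, positivity, total sum `π`, and
`sgn(M)(ξ_j + ⋯ + ξ_{j+p-1} - y) > 0` for `j = 1, …, n`. -/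
def inAy (n p : ℕ) (y : ℝ) (ξ : ℕ → ℝ) : Prop :=
  (∀ m, ξ (m + n) = ξ m) ∧
  (∀ k, 1 ≤ k → k ≤ n → 0 < ξ k) ∧
  (∑ k ∈ Finset.Icc 1 n, ξ k = Real.pi) ∧
  (∀ j, 1 ≤ j → j ≤ n → 0 < Real.sign (Mval n p y) * (wsum ξ j p - y))

/-- `|u_j(ξ)|² = sgn(M) (ξ_j + ⋯ + ξ_{j+p-1} - y)`. -/
def usq (n p : ℕ) (y : ℝ) (ξ : ℕ → ℝ) (j : ℕ) : ℝ :=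
  Real.sign (Mval n p y) * (wsum ξ j p - y)

/-- `z_ℓ(ξ, w) = sgn(sin(ny)) ∏_{d=1}^{n-1} sin(ξ_ℓ + ⋯ + ξ_{ℓ+d-1} - w)/sin(ξ_ℓ + ⋯ + ξ_{ℓ+d-1})`;
the paper's `z_ℓ(ξ, ±y)` is obtained at `w = ±y`. -/
def zfun (n : ℕ) (y : ℝ) (ξ : ℕ → ℝ) (w : ℝ) (ℓ : ℕ) : ℝ :=
  Real.sign (Real.sin ((n : ℝ) * y)) *
    ∏ d ∈ Finset.Icc 1 (n - 1), Real.sin (wsum ξ ℓ d - w) / Real.sin (wsum ξ ℓ d)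

/-- `x_j - x_ℓ` expressed through `ξ`: `ξ_ℓ + ⋯ + ξ_{j-1}` for `ℓ ≤ j`, antisymmetric. -/
def xdiff (ξ : ℕ → ℝ) (j ℓ : ℕ) : ℝ :=
  if ℓ ≤ j then wsum ξ ℓ (j - ℓ) else -(wsum ξ j (ℓ - j))

/-- `ρ(θ)_ℓ = exp(i(θ_{ℓ-1} - θ_ℓ))` (with the conventions `θ_0 = θ_n = 0` imposed
as hypotheses on `θ`). -/
def ρfun (θ : ℕ → ℝ) (ℓ : ℕ) : ℂ :=
  Complex.exp (Complex.I * ((θ (ℓ - 1) - θ ℓ : ℝ) : ℂ))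

/-- `Δ_j(θ) = exp(i Σ_{k=1}^{n-1} Ω_{j,k} θ_k)` for `1 ≤ j ≤ n-1`, and `Δ_n(θ) = 1`. -/
def Δfun (n p q : ℕ) (θ : ℕ → ℝ) (j : ℕ) : ℂ :=
  if j = n then 1
  else Complex.exp (Complex.I *
    ((∑ k ∈ Finset.Icc 1 (n - 1), (Ωent n p q j k : ℝ) * θ k : ℝ) : ℂ))

/-- The local trigonometric Lax matrix
`L(ξ,θ)_{j,ℓ} = [sin y / sin(x_j - x_ℓ + y)] v_j(ξ,y) v_ℓ(ξ,-y) ρ(θ)_ℓ`. -/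
def Lloc (n : ℕ) (y : ℝ) (ξ θ : ℕ → ℝ) (j ℓ : ℕ) : ℂ :=
  ((Real.sin y / Real.sin (xdiff ξ j ℓ + y) : ℝ) : ℂ) *
    ((Real.sqrt (zfun n y ξ y j) : ℝ) : ℂ) *
    ((Real.sqrt (zfun n y ξ (-y) ℓ) : ℝ) : ℂ) * ρfun θ ℓ

/-- The embedding map `ℰ(ξ,θ)_j = |u_j(ξ)| Δ_j(θ)^{sgn M}` for `j = 1, …, n-1`
and `ℰ(ξ,θ)_n = |u_n(ξ)|` (note `Δ_n = 1`). -/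
def Emap (n p q : ℕ) (y : ℝ) (ξ θ : ℕ → ℝ) (j : ℕ) : ℂ :=
  ((Real.sqrt (usq n p y ξ j) : ℝ) : ℂ) *
    Δfun n p q θ j ^ (if 0 < Mval n p y then (1 : ℤ) else -1)

/-- `σ(ℓ) = ℓ + n - p` if `1 ≤ ℓ ≤ p`, and `σ(ℓ) = ℓ - p` if `p < ℓ ≤ n`. -/
def σmap (n p : ℕ) (ℓ : ℕ) : ℕ := if ℓ ≤ p then ℓ + n - p else ℓ - p

/-- The Weierstrass-type function
`ws_b(z) = sin z ∏_{m=1}^∞ (1 + sin² z / sinh²(2 m b))` with `ω = π/2`, `ω' = i b`. -/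
def wsb (b : ℝ) (z : ℂ) : ℂ :=
  Complex.sin z *
    ∏' m : ℕ, (1 + Complex.sin z ^ 2 / Complex.sinh (2 * ((m : ℂ) + 1) * (b : ℂ)) ^ 2)

/-- Elliptic analogue of `zfun`, built from `ws_b` instead of `sin`. -/
def zbfun (b : ℝ) (n : ℕ) (y : ℝ) (ξ : ℕ → ℝ) (w : ℝ) (ℓ : ℕ) : ℝ :=
  Real.sign ((wsb b (((n : ℝ) * y : ℝ) : ℂ)).re) *
    ∏ d ∈ Finset.Icc 1 (n - 1),
      (wsb b ((wsum ξ ℓ d - w : ℝ) : ℂ)).re / (wsb b ((wsum ξ ℓ d : ℝ) : ℂ)).re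

/-- The local elliptic Lax matrix with spectral parameter `lam`. -/
def Lbloc (b : ℝ) (n : ℕ) (y : ℝ) (lam : ℂ) (ξ θ : ℕ → ℝ) (j ℓ : ℕ) : ℂ :=
  (wsb b ((y : ℝ) : ℂ) / wsb b lam) *
    (wsb b (((xdiff ξ j ℓ : ℝ) : ℂ) + lam) / wsb b ((xdiff ξ j ℓ + y : ℝ) : ℂ)) *
    ((Real.sqrt (zbfun b n y ξ y j) : ℝ) : ℂ) *
    ((Real.sqrt (zbfun b n y ξ (-y) ℓ) : ℝ) : ℂ) * ρfun θ ℓ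

/-- The subset `S = {ℓ p mod n : ℓ = 1, …, n-q}` of `ℤ/nℤ`. -/
def Sset (n p q : ℕ) : Finset (ZMod n) :=
  (Finset.Icc 1 (n - q)).image (fun ℓ => ((ℓ * p : ℕ) : ZMod n))

/-- The subset `S_i = {i + ℓ mod n : ℓ = 0, …, p-1}` of `ℤ/nℤ`. -/
def Siset (n p : ℕ) (i : ZMod n) : Finset (ZMod n) :=
  (Finset.range p).image (fun ℓ : ℕ => i + (ℓ : ZMod n))

/-- `I_i = |S_i ∩ S|`. -/
def Inum (n p q : ℕ) (i : ZMod n) : ℕ := (Siset n p i ∩ Sset n p q).card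

/-- The function `W_j(ξ)` of Statement 13. -/
def Wfun (n p : ℕ) (y : ℝ) (ξ : ℕ → ℝ) (j : ℕ) : ℝ :=
  (Real.sin (usq n p y ξ j) / usq n p y ξ j) *
    ((-1 : ℝ) ^ (p - 1) / Real.sin (wsum ξ j p)) *
    ∏ d ∈ (Finset.Icc 1 (n - 1)).erase p,
      Real.sin (wsum ξ j d - y) / Real.sin (wsum ξ j d)

lemma wsum_add (ξ : ℕ → ℝ) (m a b : ℕ) :
    wsum ξ m (a + b) = wsum ξ m a + wsum ξ (m + a) b := by
  simp only [wsum, Finset.sum_range_add, add_assoc]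

lemma wsum_mono {ξ : ℕ → ℝ} (h : ∀ k, 0 < ξ k) (m : ℕ) {a b : ℕ} (hab : a ≤ b) :
    wsum ξ m a ≤ wsum ξ m b :=
  Finset.sum_le_sum_of_subset_of_nonneg (by simpa using hab) fun i _ _ => (h _).le

lemma wsum_pos {ξ : ℕ → ℝ} (h : ∀ k, 0 < ξ k) (m : ℕ) {d : ℕ} (hd : 0 < d) :
    0 < wsum ξ m d :=
  Finset.sum_pos (fun _ _ => h _) (by simpa using hd.ne')

lemma exists_shift_eq {ξ : ℕ → ℝ} {n : ℕ} (hn : 0 < n) (hper : ∀ m, ξ (m + n) = ξ m) (m : ℕ) :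
    ∃ j, 1 ≤ j ∧ j ≤ n ∧ ∀ i, ξ (m + i) = ξ (j + i) := by
  induction m with
  | zero => exact ⟨n, hn, le_rfl, fun i => by rw [zero_add, add_comm, hper]⟩
  | succ m ih =>
    obtain ⟨j, hj1, hjn, hj⟩ := ih
    rcases hjn.lt_or_eq with hlt | rfl
    · refine ⟨j + 1, by omega, hlt, fun i => ?_⟩
      rw [add_assoc, hj, add_assoc]
    · refine ⟨1, le_rfl, hn, fun i => ?_⟩
      rw [add_assoc, hj, add_comm, hper]

lemma wsum_period {ξ : ℕ → ℝ} {n : ℕ} (hper : ∀ m, ξ (m + n) = ξ m) (m : ℕ) :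
    wsum ξ m n = ∑ k ∈ Finset.Icc 1 n, ξ k := by
  have step : ∀ m, wsum ξ (m + 1) n = wsum ξ m n := fun m => by
    have h1 := wsum_add ξ m 1 n
    have h2 := wsum_add ξ m n 1
    rw [add_comm 1 n] at h1
    have h3 : wsum ξ (m + n) 1 = wsum ξ m 1 := by simp [wsum, hper]
    linarith
  have base : wsum ξ 1 n = ∑ k ∈ Finset.Icc 1 n, ξ k := by
    rw [wsum, ← Finset.Ico_add_one_right_eq_Icc, Finset.sum_Ico_eq_sum_range]
    simp
  have hzero : ∀ m, wsum ξ m n = wsum ξ 0 n := fun m => by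
    induction m with
    | zero => rfl
    | succ m ih => rw [step, ih]
  rw [hzero, ← step 0, base]

lemma le_wsum_mul {ξ : ℕ → ℝ} {p : ℕ} {c : ℝ} (h : ∀ m, c ≤ wsum ξ m p) (m a : ℕ) :
    a * c ≤ wsum ξ m (a * p) := by
  induction a with
  | zero => simp [wsum]
  | succ a ih =>
    rw [Nat.succ_mul, wsum_add]
    push_cast
    linarith [h (m + a * p)]

lemma wsum_mul_le {ξ : ℕ → ℝ} {p : ℕ} {c : ℝ} (h : ∀ m, wsum ξ m p ≤ c) (m a : ℕ) :
    wsum ξ m (a * p) ≤ a * c := by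
  induction a with
  | zero => simp [wsum]
  | succ a ih =>
    rw [Nat.succ_mul, wsum_add]
    push_cast
    linarith [h (m + a * p)]

lemma wsum_mul_period {ξ : ℕ → ℝ} {n : ℕ} {c : ℝ} (h : ∀ m, wsum ξ m n = c) (m k : ℕ) :
    wsum ξ m (k * n) = k * c :=
  le_antisymm (wsum_mul_le (fun m => (h m).le) m k) (le_wsum_mul (fun m => (h m).ge) m k)

/-- For a type (i) coupling there is a threshold length `r` below which all cyclic window sums
are smaller than `y` and above which they are larger; its parity gives the sign of `sin (n y)`. -/
lemma exists_threshold {n p q : ℕ} (hp1 : 1 ≤ p) (hpn : p < n) (hq1 : 1 ≤ q) (hqn : q < n)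
    (hpq : p * q ≡ 1 [MOD n]) {y : ℝ} (hy : typeI1 n p q y ∨ typeI2 n p q y) {ξ : ℕ → ℝ}
    (hpos : ∀ k, 0 < ξ k) (hper : ∀ m, wsum ξ m n = π)
    (hwin : ∀ m, 0 < Real.sign (Mval n p y) * (wsum ξ m p - y)) :
    0 < y ∧ y < π ∧ ∃ r, r ≤ n - 1 ∧ Real.sign (Real.sin (n * y)) = (-1) ^ r ∧
      ∀ m d, (d ≤ r → wsum ξ m d < y) ∧ (r < d → y < wsum ξ m d) := by
  have hpi := Real.pi_pos
  have hn0 : (0 : ℝ) < n := by exact_mod_cast (by omega : 0 < n)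
  have hq0 : (0 : ℝ) < q := by exact_mod_cast hq1
  have hpqpos : 1 ≤ p * q := Nat.mul_pos hp1 hq1
  obtain ⟨k, hk⟩ := (Nat.modEq_iff_dvd' hpqpos).1 hpq.symm
  have hk' : p * q = k * n + 1 := by rw [mul_comm k]; omega
  have hkR : (p : ℝ) * q = k * n + 1 := by exact_mod_cast hk'
  have hypi : ∀ m, wsum ξ m p < π := fun m => by
    rw [← hper m, ← Nat.add_sub_of_le hpn.le, wsum_add]
    linarith [wsum_pos hpos (m + p) (Nat.sub_pos_of_lt hpn)]
  rcases hy with ⟨h1, h2⟩ | ⟨h1, h2⟩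
  · have hM : n * y < p * π := by rwa [lt_div_iff₀ hn0, mul_comm] at h2
    have hky : k * π < q * y := by
      have e : ((p : ℝ) / n - 1 / (n * q)) * π = k * π / q := by
        field_simp
        linear_combination hkR
      rwa [e, div_lt_iff₀ hq0, mul_comm y] at h1
    have hwin' : ∀ m, y < wsum ξ m p := fun m => by
      have := hwin m
      rw [Real.sign_of_pos (by unfold Mval; linarith)] at this
      linarith
    have hy0 : 0 < y := by
      have : 0 < (q : ℝ) * y := lt_of_le_of_lt (by positivity) hky
      exact (mul_pos_iff_of_pos_left hq0).1 this
    refine ⟨hy0, (hwin' 0).trans (hypi 0), p - 1, by omega, ?_,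
      fun m d => ⟨fun hd => ?_, fun hd => ?_⟩⟩
    · obtain ⟨s, rfl⟩ : ∃ s, p = s + 1 := ⟨p - 1, by omega⟩
      have hs : s * π < n * y := by
        have e1 : (n * k : ℝ) * π < n * (q * y) := by
          rw [mul_assoc]; exact mul_lt_mul_of_pos_left hky hn0
        have e2 : (q : ℝ) * (s * π) ≤ n * k * π := by
          have hq1' : (1 : ℝ) ≤ q := by exact_mod_cast hq1
          push_cast at hkR
          have : (q : ℝ) * s ≤ n * k := by linarith
          nlinarith
        nlinarith
      push_cast at hM
      have hsin : 0 < Real.sin (n * y - s * π) :=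
        Real.sin_pos_of_pos_of_lt_pi (by linarith) (by linarith)
      rw [Real.sin_sub_nat_mul_pi] at hsin
      rcases neg_one_pow_eq_or ℝ s with h | h <;> rw [h] at hsin <;> simp only [Nat.add_sub_cancel, h]
      · exact Real.sign_of_pos (by linarith)
      · exact Real.sign_of_neg (by linarith)
    · refine (wsum_mono hpos m hd).trans_lt ?_
      have e : k * n = (p - 1) + (q - 1) * p := by
        obtain ⟨s, rfl⟩ : ∃ s, p = s + 1 := ⟨p - 1, by omega⟩
        obtain ⟨t, rfl⟩ : ∃ t, q = t + 1 := ⟨q - 1, by omega⟩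
        simp only [Nat.add_sub_cancel]
        linarith
      have hs := wsum_add ξ m (p - 1) ((q - 1) * p)
      rw [← e, wsum_mul_period hper] at hs
      have := le_wsum_mul (fun m => (hwin' m).le) (m + (p - 1)) (q - 1)
      rw [Nat.cast_sub hq1] at this
      push_cast at this
      linarith
    · exact (hwin' m).trans_le (wsum_mono hpos m (by omega))
  · have hM : p * π < n * y := by rwa [div_lt_iff₀ hn0, mul_comm y] at h1
    have hnq : (1 : ℝ) ≤ (n : ℝ) - q := by
      have : (q : ℝ) + 1 ≤ n := by exact_mod_cast hqn
      linarith
    have hky : (n - q) * y < (p - k) * π := by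
      have hnq0 : (n : ℝ) - q ≠ 0 := by linarith
      have e : ((p : ℝ) / n + 1 / (n * (n - q))) * π = (p - k) * π / (n - q) := by
        field_simp
        linear_combination -hkR
      rwa [e, lt_div_iff₀ (by linarith), mul_comm y] at h2
    have hwin' : ∀ m, wsum ξ m p < y := fun m => by
      have := hwin m
      rw [Real.sign_of_neg (by unfold Mval; linarith)] at this
      linarith
    have hy0 : 0 < y := (wsum_pos hpos 0 hp1).trans (hwin' 0)
    have hlarge : ∀ m, y < wsum ξ m (p + 1) := fun m => by
      obtain ⟨t, ht⟩ : ∃ t, n = q + t + 1 := ⟨n - q - 1, by omega⟩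
      have hkp : k ≤ p := by
        by_contra hlt
        have h1 : (p + 1) * n ≤ k * n := Nat.mul_le_mul_right n (by omega)
        have h2 : p * q ≤ p * n := Nat.mul_le_mul_left p hqn.le
        linarith
      obtain ⟨s, rfl⟩ := Nat.exists_eq_add_of_le hkp
      have e : s * n = (k + s + 1) + t * (k + s) := by
        have h3 : (k + s) * n = (k + s) * (q + t + 1) := by rw [ht]
        linarith
      have hs := wsum_add ξ m (k + s + 1) (t * (k + s))
      rw [← e, wsum_mul_period hper] at hs
      have := wsum_mul_le (fun m => (hwin' m).le) (m + (k + s + 1)) t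
      have htR : (n : ℝ) - q = t + 1 := by rw [ht]; push_cast; ring
      rw [htR] at hky
      push_cast at hky
      linarith
    have hylt : y < π := by
      rw [← hper 0]
      exact (hlarge 0).trans_le (wsum_mono hpos 0 hpn)
    refine ⟨hy0, hylt, p, by omega, ?_, fun m d => ⟨fun hd => ?_, fun hd => ?_⟩⟩
    · have hs : n * y < (p + 1) * π := by
        have e1 := mul_lt_mul_of_pos_left hky hn0
        have e2 : (n : ℝ) * (p - k) = p * (n - q) + 1 := by linear_combination hkR
        rw [← mul_assoc (n : ℝ) (p - k), e2] at e1
        nlinarith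
      have hsin : 0 < Real.sin (n * y - p * π) :=
        Real.sin_pos_of_pos_of_lt_pi (by linarith) (by linarith)
      rw [Real.sin_sub_nat_mul_pi] at hsin
      rcases neg_one_pow_eq_or ℝ p with h | h <;> rw [h] at hsin ⊢
      · exact Real.sign_of_pos (by linarith)
      · exact Real.sign_of_neg (by linarith)
    · exact (wsum_mono hpos m hd).trans_lt (hwin' m)
    · exact (hlarge m).trans_le (wsum_mono hpos m hd)

lemma neg_one_pow_mul_prod_pos {f : ℕ → ℝ} {r N : ℕ} (hr : r ≤ N)
    (hneg : ∀ d, 1 ≤ d → d ≤ r → f d < 0) (hpos : ∀ d, r < d → d ≤ N → 0 < f d) :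
    0 < (-1) ^ r * ∏ d ∈ Finset.Icc 1 N, f d := by
  have key : ∀ k ≤ N, 0 < (-1) ^ (min r k) * ∏ d ∈ Finset.Icc 1 k, f d := fun k => by
    induction k with
    | zero => simp
    | succ k ih =>
      intro hk
      have ih := ih (by omega)
      rw [Finset.prod_Icc_succ_top (by omega)]
      by_cases h : k + 1 ≤ r
      · rw [min_eq_right h]
        rw [min_eq_right (by omega : k ≤ r)] at ih
        have := mul_pos ih (neg_pos.2 (hneg (k + 1) (by omega) h))
        rw [pow_succ]
        linarith
      · rw [min_eq_left (by omega)]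
        rw [min_eq_left (by omega)] at ih
        rw [← mul_assoc]
        exact mul_pos ih (hpos _ (by omega) hk)
  simpa [min_eq_left hr] using key N le_rfl

/-- The product of `z_j(ξ, y)` and `z_j(ξ, -y)`. -/
lemma zfun_mul_zfun_neg {n : ℕ} {y : ℝ} {ξ : ℕ → ℝ} {j : ℕ} (hny : Real.sin (n * y) ≠ 0)
    (hS : ∀ d ∈ Finset.Icc 1 (n - 1), Real.sin (wsum ξ j d) ≠ 0) :
    zfun n y ξ y j * zfun n y ξ (-y) j =
      ∏ d ∈ Finset.Icc 1 (n - 1), (1 - Real.sin y ^ 2 / Real.sin (wsum ξ j d) ^ 2) := by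
  have hs : Real.sign (Real.sin (n * y)) * Real.sign (Real.sin (n * y)) = 1 := by
    rcases Real.sign_apply_eq_of_ne_zero _ hny with h | h <;> rw [h] <;> norm_num
  unfold zfun
  rw [mul_mul_mul_comm, hs, one_mul, ← Finset.prod_mul_distrib]
  refine Finset.prod_congr rfl fun d hd => ?_
  have h := hS d hd
  rw [sub_neg_eq_add, Real.sin_sub, Real.sin_add]
  field_simp
  linear_combination Real.sin (wsum ξ j d) ^ 2 * Real.sin_sq_add_cos_sq y -
    Real.sin y ^ 2 * Real.sin_sq_add_cos_sq (wsum ξ j d)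

/-- Positivity of `z_j(ξ, y)` and `z_j(ξ, -y)` in the presence of a threshold length. -/
lemma zfun_pos {n r : ℕ} {y : ℝ} {ξ : ℕ → ℝ} (hy0 : 0 < y) (hyπ : y < π)
    (hpos : ∀ k, 0 < ξ k) (hper : ∀ m, wsum ξ m n = π) (hr : r ≤ n - 1)
    (hsign : Real.sign (Real.sin (n * y)) = (-1) ^ r)
    (hthr : ∀ m d, (d ≤ r → wsum ξ m d < y) ∧ (r < d → y < wsum ξ m d)) (j : ℕ) :
    0 < zfun n y ξ y j ∧ 0 < zfun n y ξ (-y) j := by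
  have hcompl : ∀ m d, d ≤ n → wsum ξ m d + wsum ξ (m + d) (n - d) = π := fun m d hd => by
    rw [← wsum_add, Nat.add_sub_of_le hd, hper]
  have hlt : ∀ m d, 1 ≤ d → d ≤ n - 1 → 0 < wsum ξ m d ∧ wsum ξ m d < π := fun m d h1 h2 =>
    ⟨wsum_pos hpos m h1, by
      linarith [hcompl m d (by omega), wsum_pos hpos (m + d) (by omega : 0 < n - d)]⟩
  have hsinpos : ∀ m d, 1 ≤ d → d ≤ n - 1 → 0 < Real.sin (wsum ξ m d) := fun m d h1 h2 =>
    Real.sin_pos_of_pos_of_lt_pi (hlt m d h1 h2).1 (hlt m d h1 h2).2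
  have hneg : ∀ m d, 1 ≤ d → d ≤ r → Real.sin (wsum ξ m d - y) < 0 := fun m d h1 h2 =>
    Real.sin_neg_of_neg_of_neg_pi_lt (by linarith [(hthr m d).1 h2])
      (by linarith [(hlt m d h1 (by omega)).1])
  have hge : ∀ m d, r < d → d ≤ n - 1 → 0 < Real.sin (wsum ξ m d - y) := fun m d h1 h2 =>
    Real.sin_pos_of_pos_of_lt_pi (by linarith [(hthr m d).2 h1])
      (by linarith [(hlt m d (by omega) h2).2])
  unfold zfun
  rw [hsign]
  constructor
  · exact neg_one_pow_mul_prod_pos hr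
      (fun d h1 h2 => div_neg_of_neg_of_pos (hneg j d h1 h2) (hsinpos j d h1 (by omega)))
      (fun d h1 h2 => div_pos (hge j d h1 h2) (hsinpos j d (by omega) h2))
  · have hrefl : ∏ d ∈ Finset.Icc 1 (n - 1),
        Real.sin (wsum ξ j d - -y) / Real.sin (wsum ξ j d) =
        ∏ e ∈ Finset.Icc 1 (n - 1),
          Real.sin (wsum ξ (j + (n - e)) e - y) / Real.sin (wsum ξ j (n - e)) := by
      refine Finset.prod_nbij' (fun d => n - d) (fun d => n - d) ?_ ?_ ?_ ?_ ?_
      iterate 4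
        intro d hd
        simp only [Finset.mem_Icc] at hd ⊢
        omega
      intro d hd
      rw [Finset.mem_Icc] at hd
      have hdn : n - (n - d) = d := by omega
      rw [hdn, ← Real.sin_pi_sub]
      congr 2
      linarith [hcompl j d (by omega)]
    rw [hrefl]
    exact neg_one_pow_mul_prod_pos hr
      (fun d h1 h2 => div_neg_of_neg_of_pos (hneg _ d h1 h2)
        (hsinpos j _ (by omega) (by omega)))
      (fun d h1 h2 => div_pos (hge _ d h1 h2) (hsinpos j _ (by omega) (by omega)))

/-- The real part of a diagonal entry of the local Lax matrix. -/
lemma Lloc_self_re {n : ℕ} {y : ℝ} {ξ : ℕ → ℝ} (θ : ℕ → ℝ) {i : ℕ} (hy : Real.sin y ≠ 0)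
    (hz : 0 ≤ zfun n y ξ y i) :
    (Lloc n y ξ θ i i).re =
      Real.cos (θ i - θ (i - 1)) * Real.sqrt (zfun n y ξ y i * zfun n y ξ (-y) i) := by
  have hx : xdiff ξ i i = 0 := by simp [xdiff, wsum]
  rw [Lloc, hx, zero_add, div_self hy, Real.sqrt_mul hz, ρfun, mul_comm Complex.I,
    ← Complex.ofReal_mul, ← Complex.ofReal_mul, Complex.re_ofReal_mul,
    Complex.exp_ofReal_mul_I_re, ← Real.cos_neg, neg_sub]
  ring

/-- `z_j(ξ,y) z_j(ξ,-y) = ∏_{d=1}^{n-1} [1 - sin²y/sin²(ξ_j+⋯+ξ_{j+d-1})] > 0`,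
and the real part of the trace of the local Lax matrix equals the III_b Hamiltonian. -/
theorem stmt14 (n p q : ℕ) (hn : 2 ≤ n) (hp1 : 1 ≤ p) (hpn : p ≤ n - 1)
    (hgcd : Nat.gcd n p = 1) (hq1 : 1 ≤ q) (hqn : q ≤ n - 1)
    (hpq : p * q ≡ 1 [MOD n])
    (y : ℝ) (hy : typeI1 n p q y ∨ typeI2 n p q y)
    (ξ : ℕ → ℝ) (hξ : inAy n p y ξ)
    (j : ℕ) (hj1 : 1 ≤ j) (hjn : j ≤ n)
    (θ : ℕ → ℝ) (hθ0 : θ 0 = 0) (hθn : θ n = 0) :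
    (zfun n y ξ y j * zfun n y ξ (-y) j =
      ∏ d ∈ Finset.Icc 1 (n - 1), (1 - Real.sin y ^ 2 / Real.sin (wsum ξ j d) ^ 2)) ∧
    (0 < ∏ d ∈ Finset.Icc 1 (n - 1), (1 - Real.sin y ^ 2 / Real.sin (wsum ξ j d) ^ 2)) ∧
    (∑ i ∈ Finset.Icc 1 n, Lloc n y ξ θ i i).re =
      ∑ i ∈ Finset.Icc 1 n, Real.cos (θ i - θ (i - 1)) *
        Real.sqrt (∏ d ∈ Finset.Icc 1 (n - 1),
          (1 - Real.sin y ^ 2 / Real.sin (wsum ξ i d) ^ 2)) := by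
  obtain ⟨hper, hξpos, hsum, hwin⟩ := hξ
  have hpos : ∀ k, 0 < ξ k := fun k => by
    obtain ⟨i, h1, h2, h⟩ := exists_shift_eq (by omega) hper k
    simpa using (h 0).symm ▸ hξpos (i + 0) (by omega) (by omega)
  have hperiod : ∀ m, wsum ξ m n = π := fun m => (wsum_period hper m).trans hsum
  have hwindow : ∀ m, 0 < Real.sign (Mval n p y) * (wsum ξ m p - y) := fun m => by
    obtain ⟨i, h1, h2, h⟩ := exists_shift_eq (by omega) hper m
    simpa only [wsum, h] using hwin i h1 h2
  obtain ⟨hy0, hyπ, r, hr, hsign, hthr⟩ :=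
    exists_threshold hp1 (by omega) hq1 (by omega) hpq hy hpos hperiod hwindow
  have hz := zfun_pos hy0 hyπ hpos hperiod hr hsign hthr
  have hny : Real.sin (n * y) ≠ 0 := fun h => by
    rw [h, Real.sign_zero] at hsign
    exact pow_ne_zero r (by norm_num) hsign.symm
  have hS : ∀ i, ∀ d ∈ Finset.Icc 1 (n - 1), Real.sin (wsum ξ i d) ≠ 0 := fun i d hd => by
    rw [Finset.mem_Icc] at hd
    have hlt : wsum ξ i d < π := by
      rw [← hperiod i, ← Nat.add_sub_of_le (by omega : d ≤ n), wsum_add]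
      linarith [wsum_pos hpos (i + d) (by omega : 0 < n - d)]
    exact (Real.sin_pos_of_pos_of_lt_pi (wsum_pos hpos i hd.1) hlt).ne'
  have hprod := fun i => zfun_mul_zfun_neg hny (hS i)
  refine ⟨hprod j, hprod j ▸ mul_pos (hz j).1 (hz j).2, ?_⟩
  rw [Complex.re_sum]
  refine Finset.sum_congr rfl fun i _ => ?_
  rw [← hprod i, Lloc_self_re θ (Real.sin_pos_of_pos_of_lt_pi hy0 hyπ).ne' (hz i).1.le]

end
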